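/- arXiv:2404.02488 — 7 statements merged into one kernel-verified Lean document; each statement's English description precedes it below -/
import Mathlib

section
/- Let D = (P, ℬ) be a nontrivial 2-(v,3,λ) design with v ≡ 1 or 3 (mod 6) and v ≡ 6 (mod λ), and let G be a flag-transitive group of automorphisms of D. Then either G acts 2-transitively on P, or for every point x ∈ P the stabilizer G_x has exactly two orbits on P \ {x}, each of length (v−1)/2. -/
theorem aux_mem_orbit {P : Type*} (G : Subgroup (Equiv.Perm P)) (x a y : P) :
    y ∈ MulAction.orbit (MulAction.stabilizer G x) a ↔ ∃ g ∈ G, g x = x ∧ g a = y := by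
  constructor
  · rintro ⟨⟨⟨g, hg⟩, hs⟩, rfl⟩
    exact ⟨g, hg, hs, rfl⟩
  · rintro ⟨g, hg, hs, rfl⟩
    exact ⟨⟨⟨g, hg⟩, hs⟩, rfl⟩

theorem aux_count {P : Type*} [Fintype P] [DecidableEq P] (lam : ℕ)
    (ℬ : Finset (Finset P))
    (hdesign : ∀ T : Finset P, T.card = 2 → (ℬ.filter (fun B => T ⊆ B)).card = lam)
    (x : P) (O : Finset P) (hx : x ∉ O)
    (h1 : ∀ B ∈ ℬ, x ∈ B → ∃ c, c ∈ O ∧ c ∈ B ∧ ∀ d ∈ O, d ∈ B → d = c) :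
    O.card * lam = (ℬ.filter (fun B => x ∈ B)).card := by
  have := Finset.sum_card_bipartiteAbove_eq_sum_card_bipartiteBelow
    (s := O) (t := ℬ.filter (fun B => x ∈ B)) (fun y B => y ∈ B)
  rw [Finset.sum_congr rfl (g := fun _ => lam), Finset.sum_const, smul_eq_mul,
    Finset.sum_congr rfl (g := fun _ => 1)] at this
  · simpa using this
  · intro B hB
    rw [Finset.mem_filter] at hB
    obtain ⟨c, hc, hcB, hu⟩ := h1 B hB.1 hB.2
    rw [Finset.card_eq_one]
    refine ⟨c, ?_⟩
    ext d
    simp only [Finset.bipartiteBelow, Finset.mem_filter, Finset.mem_singleton]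
    constructor
    · rintro ⟨h, h'⟩
      exact hu d h h'
    · rintro rfl
      exact ⟨hc, hcB⟩
  · intro y hy
    have hxy : x ≠ y := fun h => hx (h ▸ hy)
    rw [← hdesign {x, y} (Finset.card_pair hxy)]
    congr 1
    ext B
    simp only [Finset.bipartiteAbove, Finset.mem_filter, Finset.insert_subset_iff,
      Finset.singleton_subset_iff]
    tauto

/-- Let `D = (P, ℬ)` be a nontrivial `2-(v,3,λ)` design with
`v ≡ 1, 3 (mod 6)` and `v ≡ 6 (mod λ)`, and let `G` be a flag-transitive group of
automorphisms of `D`.  Then either `G` acts `2`-transitively on `P`, or for every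
point `x` the stabilizer `G_x` has exactly two orbits on `P \ {x}`, each of
length `(v-1)/2`. -/
theorem flag_transitive_two_transitive_or_rank_three
    {P : Type*} [Fintype P] [DecidableEq P] (v lam : ℕ)
    (ℬ : Finset (Finset P))
    (hv : Fintype.card P = v)
    (hblocks : ∀ B ∈ ℬ, B.card = 3)
    (hdesign : ∀ T : Finset P, T.card = 2 → (ℬ.filter (fun B => T ⊆ B)).card = lam)
    (hlam : 1 ≤ lam)
    (hnontriv : 3 < v)
    (hmod6 : v % 6 = 1 ∨ v % 6 = 3)
    (hmodlam : (lam : ℤ) ∣ (v : ℤ) - 6)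
    (G : Subgroup (Equiv.Perm P))
    (hGaut : ∀ g ∈ G, ∀ B ∈ ℬ, B.image g ∈ ℬ)
    (hflag : ∀ x y : P, ∀ B ∈ ℬ, ∀ C ∈ ℬ, x ∈ B → y ∈ C →
      ∃ g ∈ G, g x = y ∧ B.image g = C) :
    (∀ x y x' y' : P, x ≠ y → x' ≠ y' → ∃ g ∈ G, g x = x' ∧ g y = y') ∨
    (∀ x : P, ∃ O₁ O₂ : Set P,
      (∃ a : P, a ≠ x ∧ O₁ = MulAction.orbit (MulAction.stabilizer G x) a) ∧
      (∃ a : P, a ≠ x ∧ O₂ = MulAction.orbit (MulAction.stabilizer G x) a) ∧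
      O₁ ≠ O₂ ∧ O₁ ∪ O₂ = {x}ᶜ ∧
      O₁.ncard = (v - 1) / 2 ∧ O₂.ncard = (v - 1) / 2) := by
  have hblk : ∀ x y : P, x ≠ y → ∃ B ∈ ℬ, x ∈ B ∧ y ∈ B := by
    intro x y hxy
    have h := hdesign {x, y} (Finset.card_pair hxy)
    obtain ⟨B, hB⟩ := Finset.card_pos.1 (by omega : 0 < (ℬ.filter (fun B => {x, y} ⊆ B)).card)
    simp only [Finset.mem_filter, Finset.insert_subset_iff, Finset.singleton_subset_iff] at hB
    exact ⟨B, hB.1, hB.2⟩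
  have hne : ∀ x : P, ∃ y, x ≠ y := by
    intro x
    have : Nontrivial P := Fintype.one_lt_card_iff_nontrivial.1 (by omega)
    obtain ⟨y, hy⟩ := exists_ne x
    exact ⟨y, hy.symm⟩
  have htrans : ∀ x y : P, ∃ g ∈ G, g x = y := by
    intro x y
    obtain ⟨x', hx'⟩ := hne x
    obtain ⟨y', hy'⟩ := hne y
    obtain ⟨B, hB, hxB, -⟩ := hblk _ _ hx'
    obtain ⟨C, hC, hyC, -⟩ := hblk _ _ hy'
    obtain ⟨g, hg, h, -⟩ := hflag x y B hB C hC hxB hyC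
    exact ⟨g, hg, h⟩
  by_cases hT : ∃ x : P, ∀ y z : P, y ≠ x → z ≠ x → ∃ g ∈ G, g x = x ∧ g y = z
  · left
    obtain ⟨p, hp⟩ := hT
    intro x y x' y' hxy hxy'
    obtain ⟨h, hh, hhx⟩ := htrans x p
    obtain ⟨k, hk, hkx⟩ := htrans x' p
    obtain ⟨g, hg, hgp, hgy⟩ := hp (h y) (k y') (fun e => hxy (h.injective (hhx.trans e.symm)))
      (fun e => hxy' (k.injective (hkx.trans e.symm)))
    refine ⟨k⁻¹ * g * h, G.mul_mem (G.mul_mem (G.inv_mem hk) hg) hh, ?_, ?_⟩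
    · simp only [Equiv.Perm.mul_apply, hhx, hgp]
      rw [← hkx]; simp
    · simp only [Equiv.Perm.mul_apply, hgy]
      simp
  · right
    intro x
    obtain ⟨a, hxa⟩ := hne x
    obtain ⟨B, hB, hxB, haB⟩ := hblk _ _ hxa
    obtain ⟨b, hxb, hab, hBe⟩ : ∃ b, x ≠ b ∧ a ≠ b ∧ B = {x, a, b} := by
      have h2 : ({x, a} : Finset P).card = 2 := Finset.card_pair hxa
      have hs : ({x, a} : Finset P) ⊆ B := by
        simp [Finset.insert_subset_iff, hxB, haB]
      have h3 := Finset.card_sdiff_add_card_eq_card hs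
      rw [h2, hblocks B hB] at h3
      obtain ⟨b, hb⟩ := Finset.card_eq_one.1 (by omega : (B \ {x, a}).card = 1)
      have hbm : b ∈ B \ {x, a} := by rw [hb]; simp
      simp only [Finset.mem_sdiff, Finset.mem_insert, Finset.mem_singleton, not_or] at hbm
      refine ⟨b, fun e => hbm.2.1 e.symm, fun e => hbm.2.2 e.symm, ?_⟩
      rw [← Finset.sdiff_union_of_subset hs, hb]
      ext z; simp; tauto
    subst hBe
    have hC : ∀ C ∈ ℬ, x ∈ C → ∃ g ∈ G, g x = x ∧ C = {x, g a, g b} := by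
      intro C hC hxC
      obtain ⟨g, hg, hgx, rfl⟩ := hflag x x _ hB C hC hxB hxC
      refine ⟨g, hg, hgx, ?_⟩
      simp [Finset.image_insert, hgx]
    have hcov : ∀ y, x ≠ y → (∃ g ∈ G, g x = x ∧ g a = y) ∨ (∃ g ∈ G, g x = x ∧ g b = y) := by
      intro y hy
      obtain ⟨C, hCB, hxC, hyC⟩ := hblk _ _ hy
      obtain ⟨g, hg, hgx, rfl⟩ := hC C hCB hxC
      simp only [Finset.mem_insert, Finset.mem_singleton] at hyC
      rcases hyC with h | h | h
      · exact absurd h.symm hy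
      · exact Or.inl ⟨g, hg, hgx, h.symm⟩
      · exact Or.inr ⟨g, hg, hgx, h.symm⟩
    have hcomp : ∀ p q r : P, (∃ g ∈ G, g x = x ∧ g p = q) → (∃ g ∈ G, g x = x ∧ g q = r) →
        (∃ g ∈ G, g x = x ∧ g p = r) := by
      rintro p q r ⟨g, hg, h1, h2⟩ ⟨k, hk, h3, h4⟩
      exact ⟨k * g, G.mul_mem hk hg, by simp [h1, h3], by simp [h2, h4]⟩
    have hinv : ∀ p q : P, (∃ g ∈ G, g x = x ∧ g p = q) → (∃ g ∈ G, g x = x ∧ g q = p) := by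
      rintro p q ⟨g, hg, h1, h2⟩
      exact ⟨g⁻¹, G.inv_mem hg, by rw [Equiv.Perm.inv_eq_iff_eq, h1],
        by rw [Equiv.Perm.inv_eq_iff_eq, h2]⟩
    have hnab : ¬ ∃ g ∈ G, g x = x ∧ g a = b := by
      intro h
      apply hT
      have hall : ∀ y, y ≠ x → ∃ g ∈ G, g x = x ∧ g a = y := by
        intro y hy
        rcases hcov y hy.symm with h' | h'
        · exact h'
        · exact hcomp _ _ _ h h'
      exact ⟨x, fun y z hy hz => hcomp _ _ _ (hinv _ _ (hall y hy)) (hall z hz)⟩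
    have hfix : ∀ p, x ≠ p → ¬ ∃ g ∈ G, g x = x ∧ g p = x := by
      rintro p hp ⟨g, hg, h1, h2⟩
      exact hp (g.injective (h1.trans h2.symm))
    classical
    let A : Finset P := Finset.univ.filter (fun y => ∃ g ∈ G, g x = x ∧ g a = y)
    let A' : Finset P := Finset.univ.filter (fun y => ∃ g ∈ G, g x = x ∧ g b = y)
    have hA : ∀ y, y ∈ A ↔ ∃ g ∈ G, g x = x ∧ g a = y := fun y => by simp [A]
    have hA' : ∀ y, y ∈ A' ↔ ∃ g ∈ G, g x = x ∧ g b = y := fun y => by simp [A']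
    have hdisj : ∀ y, y ∈ A → y ∈ A' → False := fun y h h' =>
      hnab (hcomp _ _ _ ((hA y).1 h) (hinv _ _ ((hA' y).1 h')))
    have hxA : x ∉ A := fun h => hfix a hxa ((hA x).1 h)
    have hxA' : x ∉ A' := fun h => hfix b hxb ((hA' x).1 h)
    have c1 := aux_count lam ℬ hdesign x A hxA (by
      intro C hCB hxC
      obtain ⟨g, hg, hgx, rfl⟩ := hC C hCB hxC
      refine ⟨g a, (hA _).2 ⟨g, hg, hgx, rfl⟩, by simp, ?_⟩
      intro d hd hdC
      simp only [Finset.mem_insert, Finset.mem_singleton] at hdC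
      rcases hdC with h | h | h
      · exact absurd (h ▸ hd) hxA
      · exact h
      · exact (hdisj d hd ((hA' _).2 ⟨g, hg, hgx, h.symm⟩)).elim)
    have c2 := aux_count lam ℬ hdesign x A' hxA' (by
      intro C hCB hxC
      obtain ⟨g, hg, hgx, rfl⟩ := hC C hCB hxC
      refine ⟨g b, (hA' _).2 ⟨g, hg, hgx, rfl⟩, by simp, ?_⟩
      intro d hd hdC
      simp only [Finset.mem_insert, Finset.mem_singleton] at hdC
      rcases hdC with h | h | h
      · exact absurd (h ▸ hd) hxA'
      · exact (hdisj d ((hA _).2 ⟨g, hg, hgx, h.symm⟩) hd).elim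
      · exact h)
    have c3 : A.card = A'.card := Nat.eq_of_mul_eq_mul_right hlam (c1.trans c2.symm)
    have hun : A ∪ A' = {x}ᶜ := by
      ext y
      rw [Finset.mem_union, Finset.mem_compl, Finset.mem_singleton]
      constructor
      · rintro h rfl
        exact h.elim hxA hxA'
      · intro h
        rw [hA, hA']
        exact hcov y (fun e => h e.symm)
    have c4 : A.card + A'.card = v - 1 := by
      rw [← Finset.card_union_of_disjoint (Finset.disjoint_left.2 (fun y => hdisj y)), hun,
        Finset.card_compl, hv, Finset.card_singleton]
    have e1 : MulAction.orbit (MulAction.stabilizer G x) a = (A : Set P) := by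
      ext y; rw [aux_mem_orbit, Finset.mem_coe, hA]
    have e2 : MulAction.orbit (MulAction.stabilizer G x) b = (A' : Set P) := by
      ext y; rw [aux_mem_orbit, Finset.mem_coe, hA']
    refine ⟨A, A', ⟨a, hxa.symm, e1.symm⟩, ⟨b, hxb.symm, e2.symm⟩, ?_, ?_, ?_, ?_⟩
    · intro h
      have h' : A = A' := Finset.coe_injective h
      have haA : a ∈ A := (hA a).2 ⟨1, G.one_mem, rfl, rfl⟩
      exact hdisj a haA (h' ▸ haA)
    · rw [← Finset.coe_union, hun]; simp
    · rw [Set.ncard_coe_finset]; omega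
    · rw [Set.ncard_coe_finset]; omega
end

section
/- Let p be an odd prime, d ≥ 1, V = 𝔽_p^d, and let D = (V, ℬ) be a nontrivial 2-(p^d, 3, λ) design whose point set is V, with p^d ≡ 1 or 3 (mod 6) and p^d ≡ 6 (mod λ). Suppose G is a group of affine permutations of V (each element of the form x ↦ Ax + b with A ∈ GL(V) and b ∈ V) which contains every translation x ↦ x + b, acts 2-transitively on V, and acts flag-transitively on D. Then p = 3 and the blocks of D are exactly the affine lines of V = 𝔽_3^d, i.e. ℬ is the set of all 3-element subsets {x,y,z} of V with x + y + z = 0. -/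
open scoped Pointwise in
lemma fixed_block_aux {V : Type*} [Fintype V] [DecidableEq V]
    (K : Subgroup (Equiv.Perm V)) (F : Finset (Finset V)) (hodd : ¬ 2 ∣ F.card)
    (hK : ∀ g ∈ K, ∀ B ∈ F, B.image g ∈ F) :
    ∃ (P : Sylow 2 K) (B : Finset V), B ∈ F ∧ ∀ g : K, g ∈ P → B.image (g : Equiv.Perm V) = B := by
  haveI : Fact (Nat.Prime 2) := ⟨Nat.prime_two⟩
  obtain ⟨P⟩ : Nonempty (Sylow 2 K) := inferInstance
  letI act : MulAction P {B // B ∈ F} :=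
    { smul := fun g B => ⟨B.1.image ((g : K) : Equiv.Perm V), hK _ (g : K).2 _ B.2⟩
      one_smul := by
        intro B
        apply Subtype.ext
        change B.1.image _ = B.1
        simp
      mul_smul := by
        intro g h B
        apply Subtype.ext
        change B.1.image _ = (B.1.image _).image _
        rw [Finset.image_image]
        rfl }
  have hc : ¬ 2 ∣ Nat.card {B // B ∈ F} := by simpa using hodd
  obtain ⟨B, hB⟩ := P.isPGroup'.nonempty_fixed_point_of_prime_not_dvd_card {B // B ∈ F} hc
  refine ⟨P, B.1, B.2, fun g hg => ?_⟩
  have := hB ⟨g, hg⟩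
  exact congrArg Subtype.val this

/-- Let `p` be an odd prime, `d ≥ 1`, `V = 𝔽_p^d`, and let
`D = (V, ℬ)` be a nontrivial `2-(p^d, 3, λ)` design with `p^d ≡ 1, 3 (mod 6)`
and `p^d ≡ 6 (mod λ)`.  Suppose `G` is a group of affine permutations of `V`
containing all translations, acting `2`-transitively on `V` and
flag-transitively on `D`.  Then `p = 3` and the blocks of `D` are exactly the
affine lines of `𝔽_3^d`, i.e. the `3`-element subsets with zero sum. -/
theorem affine_flag_transitive_design_is_AG
    (p d : ℕ) (hp : p.Prime) (hpodd : Odd p) (hd : 1 ≤ d)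
    (lam : ℕ) (hlam : 1 ≤ lam)
    (ℬ : Finset (Finset (Fin d → ZMod p)))
    (hblocks : ∀ B ∈ ℬ, B.card = 3)
    (hdesign : ∀ T : Finset (Fin d → ZMod p), T.card = 2 →
      (ℬ.filter (fun B => T ⊆ B)).card = lam)
    (hnontriv : 3 < p ^ d)
    (hmod6 : p ^ d % 6 = 1 ∨ p ^ d % 6 = 3)
    (hmodlam : (lam : ℤ) ∣ (p : ℤ) ^ d - 6)
    (G : Subgroup (Equiv.Perm (Fin d → ZMod p)))
    (haffine : ∀ g ∈ G, ∃ (A : (Fin d → ZMod p) ≃ₗ[ZMod p] (Fin d → ZMod p))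
      (b : Fin d → ZMod p), ∀ x, g x = A x + b)
    (htrans : ∀ b : Fin d → ZMod p, Equiv.addRight b ∈ G)
    (h2trans : ∀ x y x' y' : Fin d → ZMod p, x ≠ y → x' ≠ y' →
      ∃ g ∈ G, g x = x' ∧ g y = y')
    (hGaut : ∀ g ∈ G, ∀ B ∈ ℬ, B.image g ∈ ℬ)
    (hflag : ∀ x y : Fin d → ZMod p, ∀ B ∈ ℬ, ∀ C ∈ ℬ, x ∈ B → y ∈ C →
      ∃ g ∈ G, g x = y ∧ B.image g = C) :
    p = 3 ∧ ∀ B : Finset (Fin d → ZMod p), B ∈ ℬ ↔ B.card = 3 ∧ B.sum id = 0 := by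
  haveI : Fact p.Prime := ⟨hp⟩
  have hp2 : p ≠ 2 := by rintro rfl; exact absurd hpodd (by decide)
  have h2 : (2 : ZMod p) ≠ 0 := by
    intro h
    have : ((2 : ℕ) : ZMod p) = 0 := by exact_mod_cast h
    rw [ZMod.natCast_eq_zero_iff] at this
    exact hp2 ((Nat.prime_dvd_prime_iff_eq hp Nat.prime_two).1 this)
  have hdbl : ∀ z : Fin d → ZMod p, z + z = 0 → z = 0 := by
    intro z hz
    rw [← two_smul (ZMod p) z] at hz
    exact (smul_eq_zero.1 hz).resolve_left h2
  have hneg : ∀ z : Fin d → ZMod p, z ≠ 0 → z ≠ -z := by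
    intro z hz h
    apply hz
    apply hdbl
    nth_rewrite 2 [h]
    simp
  have hlamodd : ¬ 2 ∣ lam := by
    intro h
    have h1 : ((2 : ℕ) : ℤ) ∣ (p : ℤ) ^ d - 6 := (Int.natCast_dvd_natCast.2 h).trans hmodlam
    have h3 : Odd ((p : ℤ) ^ d) := ((Int.odd_coe_nat p).2 hpodd).pow
    obtain ⟨a, ha⟩ := h1
    obtain ⟨b, hb⟩ := h3
    push_cast at ha
    omega
  -- affine maps respect midpoints
  have hmid : ∀ g ∈ G, ∀ a z : Fin d → ZMod p, g (a + z) + g (a - z) = g a + g a := by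
    intro g hg a z
    obtain ⟨A, b, h⟩ := haffine g hg
    rw [h, h, h, map_add, map_sub]
    abel
  have key : ∀ y : Fin d → ZMod p, y ≠ 0 → ({y, -y, 0} : Finset (Fin d → ZMod p)) ∈ ℬ := by
    intro y hy
    have hyn := hneg y hy
    let K : Subgroup (Equiv.Perm (Fin d → ZMod p)) :=
      { carrier := {g | g ∈ G ∧ g 0 = 0 ∧ (g y = y ∨ g y = -y)}
        one_mem' := ⟨G.one_mem, rfl, Or.inl rfl⟩
        mul_mem' := by
          rintro g h ⟨hg, hg0, hgy⟩ ⟨hh, hh0, hhy⟩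
          refine ⟨G.mul_mem hg hh, by simp [hh0, hg0], ?_⟩
          have := hmid g hg 0 y
          simp only [zero_add, zero_sub, hg0] at this
          have h3 : g (-y) = - g y := (neg_eq_of_add_eq_zero_right this).symm
          simp only [Equiv.Perm.mul_apply]
          rcases hhy with h | h <;> rcases hgy with h' | h' <;> simp [h, h', h3]
        inv_mem' := by
          rintro g ⟨hg, hg0, hgy⟩
          have := hmid g hg 0 y
          simp only [zero_add, zero_sub, hg0] at this
          have h3 : g (-y) = - g y := (neg_eq_of_add_eq_zero_right this).symm
          refine ⟨G.inv_mem hg, ?_, ?_⟩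
          · rw [Equiv.Perm.inv_eq_iff_eq, hg0]
          · rw [Equiv.Perm.inv_eq_iff_eq, Equiv.Perm.inv_eq_iff_eq, h3]
            rcases hgy with h | h <;> simp [h] }
    have hKn : ∀ g ∈ K, g (-y) = - g y := by
      rintro g ⟨hg, hg0, hgy⟩
      have := hmid g hg 0 y
      simp only [zero_add, zero_sub, hg0] at this
      exact (neg_eq_of_add_eq_zero_right this).symm
    let H : Subgroup (Equiv.Perm (Fin d → ZMod p)) :=
      G ⊓ MulAction.stabilizer _ (0 : Fin d → ZMod p) ⊓ MulAction.stabilizer _ y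
    have hHmem : ∀ g, g ∈ H ↔ g ∈ G ∧ g 0 = 0 ∧ g y = y := by
      intro g
      simp only [H, Subgroup.mem_inf, MulAction.mem_stabilizer_iff, Equiv.Perm.smul_def, and_assoc]
    have hHK : H ≤ K := by
      intro g hg
      obtain ⟨h1, h3, h4⟩ := (hHmem g).1 hg
      exact ⟨h1, h3, Or.inl h4⟩
    have hcard : 2 * Nat.card H = Nat.card K := by
      have hidx : (H.subgroupOf K).index = 2 := by
        rw [Subgroup.index_eq_two_iff]
        obtain ⟨a, haG, ha1, ha2⟩ := h2trans y (-y) (-y) y hyn hyn.symm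
        have ha0 : a 0 = 0 := by
          have := hmid a haG 0 y
          simp only [zero_add, zero_sub, ha1, ha2, neg_add_cancel] at this
          exact hdbl _ this.symm
        refine ⟨⟨a, haG, ha0, Or.inr ha1⟩, ?_⟩
        rintro ⟨b, hb⟩
        have hbn := hKn b hb
        obtain ⟨hbG, hb0, hby⟩ := hb
        simp only [Subgroup.mem_subgroupOf, hHmem, Subgroup.coe_mul, Equiv.Perm.mul_apply, ha0, ha1,
          hbn, hb0, hbG, G.mul_mem hbG haG, true_and]
        rcases hby with h | h
        · right
          exact ⟨h, by rw [h]; exact hyn.symm⟩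
        · left
          exact ⟨by rw [h, neg_neg], by rw [h]; exact hyn.symm⟩
      have h1 := (H.subgroupOf K).index_mul_card
      rw [hidx, Nat.card_congr (Subgroup.subgroupOfEquivOfLe hHK).toEquiv] at h1
      exact h1
    obtain ⟨P, B, hBF, hPB⟩ := fixed_block_aux K
      (ℬ.filter (fun B => ({y, -y} : Finset (Fin d → ZMod p)) ⊆ B))
      (by rw [hdesign _ (Finset.card_pair hyn)]; exact hlamodd)
      (by
        intro g hg B hB
        rw [Finset.mem_filter] at hB ⊢
        refine ⟨hGaut g hg.1 B hB.1, ?_⟩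
        have hsub := hB.2
        simp only [Finset.insert_subset_iff, Finset.singleton_subset_iff] at hsub ⊢
        have hn := hKn g hg
        rcases hg.2.2 with h | h
        · exact ⟨Finset.mem_image.2 ⟨y, hsub.1, h⟩,
            Finset.mem_image.2 ⟨-y, hsub.2, by rw [hn, h]⟩⟩
        · exact ⟨Finset.mem_image.2 ⟨-y, hsub.2, by rw [hn, h, neg_neg]⟩,
            Finset.mem_image.2 ⟨y, hsub.1, h⟩⟩)
    rw [Finset.mem_filter] at hBF
    obtain ⟨hBℬ, hsub⟩ := hBF
    have hsd : (B \ {y, -y}).card = 1 := by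
      rw [Finset.card_sdiff_of_subset hsub, hblocks B hBℬ, Finset.card_pair hyn]
    obtain ⟨s, hs⟩ := Finset.card_eq_one.1 hsd
    have hsB : s ∈ B \ {y, -y} := by rw [hs]; simp
    have hBeq : B = {y, -y, s} := by
      have := Finset.sdiff_union_of_subset hsub
      rw [← this, hs]
      ext t
      simp only [Finset.mem_union, Finset.mem_insert, Finset.mem_singleton]
      tauto
    simp only [Finset.mem_sdiff, Finset.mem_insert, Finset.mem_singleton, not_or] at hsB
    have hPs : ∀ g : K, g ∈ P → (g : Equiv.Perm (Fin d → ZMod p)) s = s := by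
      intro g hg
      have h1 : (g : Equiv.Perm (Fin d → ZMod p)) s ∈ B := by
        have h0 := Finset.mem_image_of_mem (g : Equiv.Perm (Fin d → ZMod p)) hsB.1
        rwa [hPB g hg] at h0
      have hn := hKn g g.2
      have hgy := g.2.2.2
      rw [hBeq] at h1
      simp only [Finset.mem_insert, Finset.mem_singleton] at h1
      have inj := (g : Equiv.Perm (Fin d → ZMod p)).injective
      rcases h1 with h1 | h1 | h1
      · exfalso
        rcases hgy with h | h
        · exact hsB.2.1 (inj (h1.trans h.symm))
        · exact hsB.2.2 (inj (by rw [h1, hn, h, neg_neg]))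
      · exfalso
        rcases hgy with h | h
        · exact hsB.2.2 (inj (by rw [h1, hn, h]))
        · exact hsB.2.1 (inj (h1.trans h.symm))
      · exact h1
    have hs0 : s = 0 := by
      by_contra hs0
      obtain ⟨c, hcG, hc0, hcs⟩ := h2trans 0 s 0 y (Ne.symm hs0) (Ne.symm hy)
      let f : K →* Equiv.Perm (Fin d → ZMod p) := (MulAut.conj c).toMonoidHom.comp K.subtype
      have hf : Function.Injective f :=
        (MulAut.conj c).injective.comp K.subtype_injective
      have hle : (P : Subgroup K).map f ≤ H := by
        rintro _ ⟨g, hg, rfl⟩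
        rw [hHmem]
        have e : f g = c * (g : Equiv.Perm (Fin d → ZMod p)) * c⁻¹ := rfl
        have i0 : c⁻¹ 0 = 0 := by rw [Equiv.Perm.inv_eq_iff_eq, hc0]
        have is : c⁻¹ y = s := by rw [Equiv.Perm.inv_eq_iff_eq, hcs]
        rw [e]
        refine ⟨G.mul_mem (G.mul_mem hcG g.2.1) (G.inv_mem hcG), ?_, ?_⟩
        · simp only [Equiv.Perm.mul_apply, i0, g.2.2.1, hc0]
        · simp only [Equiv.Perm.mul_apply, is, hPs g hg, hcs]
      have hdvd := Subgroup.card_dvd_of_le hle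
      rw [Subgroup.card_map_of_injective hf] at hdvd
      obtain ⟨m, hm⟩ := hdvd
      have h1 := (P : Subgroup K).card_mul_index
      haveI : Fact (Nat.Prime 2) := ⟨Nat.prime_two⟩
      have h3 := P.not_dvd_index
      apply h3
      refine ⟨m, ?_⟩
      have hpos : 0 < Nat.card (P : Subgroup K) := Nat.card_pos
      apply Nat.eq_of_mul_eq_mul_left hpos
      rw [h1, ← hcard, hm]
      ring
    rw [hs0] at hBeq
    rw [← hBeq]
    exact hBℬ
  -- a nonzero vector
  haveI : Nonempty (Fin d) := ⟨⟨0, hd⟩⟩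
  obtain ⟨y, hy⟩ := exists_ne (0 : Fin d → ZMod p)
  have hB0 := key y hy
  have hyn := hneg y hy
  have hny : (-y) ≠ 0 := neg_ne_zero.2 hy
  have hsum0 : ∀ g : Equiv.Perm (Fin d → ZMod p), g ∈ G →
      (({y, -y, 0} : Finset (Fin d → ZMod p)).image g).sum id = g 0 + g 0 + g 0 := by
    intro g hg
    rw [Finset.sum_image (fun a _ b _ h => g.injective h), Finset.sum_insert (by simp [hyn, hy]),
      Finset.sum_insert (by simpa using hy), Finset.sum_singleton]
    have := hmid g hg 0 y
    simp only [zero_add, zero_sub] at this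
    simp only [id, ← add_assoc, this]
  have h3y : y + y + y = 0 := by
    obtain ⟨g, hg, hg0, hgB⟩ := hflag 0 y _ hB0 _ hB0 (by simp) (by simp)
    have h1 := hsum0 g hg
    rw [hgB, hg0, Finset.sum_insert (by simp [hyn, hy]),
      Finset.sum_insert (by simpa using hy), Finset.sum_singleton] at h1
    simpa using h1.symm
  have h3 : (3 : ZMod p) = 0 := by
    have h1 : (3 : ZMod p) • y = 0 := by
      rw [← h3y]
      module
    exact (smul_eq_zero.1 h1).resolve_right hy
  have hp3 : p = 3 := by
    have : ((3 : ℕ) : ZMod p) = 0 := by exact_mod_cast h3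
    rw [ZMod.natCast_eq_zero_iff] at this
    exact (Nat.prime_dvd_prime_iff_eq hp Nat.prime_three).1 this
  have h3z : ∀ z : Fin d → ZMod p, z + z + z = 0 := by
    intro z
    have : z + z + z = (3 : ZMod p) • z := by module
    rw [this, h3, zero_smul]
  refine ⟨hp3, fun B => ⟨fun hB => ⟨hblocks B hB, ?_⟩, ?_⟩⟩
  · obtain ⟨t, ht⟩ : B.Nonempty := Finset.card_pos.1 (by rw [hblocks B hB]; norm_num)
    obtain ⟨g, hg, -, hgB⟩ := hflag 0 t _ hB0 B hB (by simp) ht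
    rw [← hgB, hsum0 g hg, h3z]
  · rintro ⟨hc, hsum⟩
    obtain ⟨a, b, c, hab, hac, hbc, rfl⟩ := Finset.card_eq_three.1 hc
    rw [Finset.sum_insert (by simp [hab, hac]),
      Finset.sum_insert (by simpa using hbc), Finset.sum_singleton] at hsum
    simp only [id] at hsum
    have h1 := hGaut _ (htrans c) _ (key (a - c) (sub_ne_zero.2 hac))
    have hb : -(a - c) + c = b := by
      have h4 : b = -(a + c) := by
        rw [eq_neg_iff_add_eq_zero, ← hsum]; abel
      have h5 := h3z c
      have h6 : c + c = -c := by rw [eq_neg_iff_add_eq_zero]; exact h5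
      rw [h4]
      calc -(a - c) + c = -a + (c + c) := by abel
        _ = -(a + c) := by rw [h6]; abel
    rw [neg_sub] at hb
    simpa [Finset.image_insert, hb] using h1
end

section
/- Let F be a finite field with |F| = q and let h ≥ 2. For any fixed point x of the projective space ℙ(F^h), the number of triangles containing x equals q³(q^{h−1}−1)(q^{h−2}−1) / (2(q−1)²). -/
/-- A `3`-element set of points of `ℙ(F^h)` is a triangle if it does not lie in a
common subspace of dimension at most `2` (equivalently, representative vectors of
its points are linearly independent). -/
def IsTriangle {F : Type*} [Field F] {h : ℕ}
    (B : Finset (Projectivization F (Fin h → F))) : Prop :=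
  B.card = 3 ∧ ¬ ∃ W : Submodule F (Fin h → F), Module.finrank F W ≤ 2 ∧
    ∀ p ∈ B, Projectivization.submodule p ≤ W

open Projectivization in
theorem aux_finrank_sup {F : Type*} [Field F] {h : ℕ}
    (x y : Projectivization F (Fin h → F)) (hxy : y ≠ x) :
    Module.finrank F (x.submodule ⊔ y.submodule : Submodule F (Fin h → F)) = 2 := by
  have h1 := Submodule.finrank_sup_add_finrank_inf_eq x.submodule y.submodule
  rw [finrank_submodule, finrank_submodule] at h1
  have h2 : Module.finrank F (x.submodule ⊓ y.submodule : Submodule F (Fin h → F)) ≠ 1 := by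
    intro h3
    have ha : x.submodule ⊓ y.submodule = x.submodule :=
      Submodule.eq_of_le_of_finrank_eq inf_le_left (by rw [h3, finrank_submodule])
    have hb : x.submodule ⊓ y.submodule = y.submodule :=
      Submodule.eq_of_le_of_finrank_eq inf_le_right (by rw [h3, finrank_submodule])
    exact hxy (submodule_injective (hb.symm.trans ha))
  have h4 := Submodule.finrank_mono (inf_le_left : x.submodule ⊓ y.submodule ≤ x.submodule)
  rw [finrank_submodule] at h4
  omega

open Projectivization in
theorem aux_card_not_le {F : Type*} [Field F] [Fintype F] {h : ℕ}
    (W : Submodule F (Fin h → F)) :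
    {p : Projectivization F (Fin h → F) | ¬ p.submodule ≤ W}.ncard * (Fintype.card F - 1)
      = Fintype.card F ^ h - Fintype.card F ^ (Module.finrank F W) := by
  have e1 : {p : Projectivization F (Fin h → F) | p.submodule ≤ W}
      = Set.range (Projectivization.map W.subtype W.injective_subtype) := by
    ext p
    constructor
    · intro hp
      have hm : p.rep ∈ W := by
        apply hp
        rw [submodule_eq]
        exact Submodule.mem_span_singleton_self _
      refine ⟨mk F ⟨p.rep, hm⟩ (fun h0 => p.rep_nonzero (congrArg Subtype.val h0)), ?_⟩
      rw [map_mk]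
      exact mk_rep p
    · rintro ⟨w, rfl⟩
      induction w using Projectivization.ind with
      | h v hv =>
        rw [map_mk]
        simp [submodule_mk]
  have e2 : {p : Projectivization F (Fin h → F) | p.submodule ≤ W}.ncard
      = Nat.card (Projectivization F W) := by
    rw [e1, ← Set.image_univ, Set.ncard_image_of_injective _ (map_injective _ _), Set.ncard_univ]
  have e3 := Set.ncard_add_ncard_compl {p : Projectivization F (Fin h → F) | p.submodule ≤ W}
  rw [e2] at e3
  have e4 := Projectivization.card' F W
  have e5 := Projectivization.card' F (Fin h → F)
  have e6 : Nat.card W = Fintype.card F ^ (Module.finrank F W) := by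
    rw [Module.natCard_eq_pow_finrank (K := F), Nat.card_eq_fintype_card]
  have e7 : Nat.card (Fin h → F) = Fintype.card F ^ h := by
    rw [Module.natCard_eq_pow_finrank (K := F), Nat.card_eq_fintype_card]; simp
  have e8 : {p : Projectivization F (Fin h → F) | p.submodule ≤ W}ᶜ = {p | ¬ p.submodule ≤ W} := rfl
  rw [e8] at e3
  rw [← e6, ← e7, e4, e5, ← e3, Nat.card_eq_fintype_card (α := F), add_mul]
  simp only [Nat.add_sub_add_right, Nat.add_sub_cancel_left]

theorem aux_isTriangle {F : Type*} [Field F] {h : ℕ}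
    [DecidableEq (Projectivization F (Fin h → F))]
    (x y z : Projectivization F (Fin h → F)) (hxy : y ≠ x) :
    IsTriangle {x, y, z} ↔ ¬ z.submodule ≤ x.submodule ⊔ y.submodule := by
  have hf := aux_finrank_sup x y hxy
  constructor
  · rintro ⟨_, h2⟩ hz
    refine h2 ⟨_, hf.le, ?_⟩
    intro p hp
    simp only [Finset.mem_insert, Finset.mem_singleton] at hp
    rcases hp with rfl | rfl | rfl
    · exact le_sup_left
    · exact le_sup_right
    · exact hz
  · intro hz
    constructor
    · rw [Finset.card_eq_three]
      refine ⟨x, y, z, hxy.symm, ?_, ?_, rfl⟩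
      · rintro rfl; exact hz le_sup_left
      · rintro rfl; exact hz le_sup_right
    · rintro ⟨W, hW, hB⟩
      have h1 : x.submodule ⊔ y.submodule ≤ W :=
        sup_le (hB x (by simp)) (hB y (by simp))
      have h2 := Submodule.eq_of_le_of_finrank_le h1 (by omega)
      exact hz (h2 ▸ hB z (by simp))

/-- Let `F` be a finite field with `|F| = q` and `h ≥ 2`.  For any fixed
point `x` of `ℙ(F^h)`, the number of triangles containing `x` equals
`q³ (q^{h-1} - 1)(q^{h-2} - 1) / (2 (q-1)²)`. -/
theorem card_triangles_through_point
    (F : Type*) [Field F] [Fintype F] (q h : ℕ)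
    (hq : Fintype.card F = q) (hh : 2 ≤ h)
    (x : Projectivization F (Fin h → F)) :
    2 * (q - 1) ^ 2 *
      {B : Finset (Projectivization F (Fin h → F)) | IsTriangle B ∧ x ∈ B}.ncard
      = q ^ 3 * (q ^ (h - 1) - 1) * (q ^ (h - 2) - 1) := by
  classical
  have hq1 : 1 < q := hq ▸ Fintype.one_lt_card
  have : Fintype (Projectivization F (Fin h → F)) := Fintype.ofFinite _
  let s : Finset (Projectivization F (Fin h → F)) := Finset.univ.filter (fun y => y ≠ x)
  let t : Finset (Finset (Projectivization F (Fin h → F))) :=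
    Finset.univ.filter (fun B => IsTriangle B ∧ x ∈ B)
  have hs : s.card * (q - 1) = q ^ h - q := by
    have := aux_card_not_le x.submodule
    rw [Projectivization.finrank_submodule, hq, pow_one] at this
    rw [← this, ← Set.ncard_coe_finset]
    congr 2
    ext p
    simp only [s, Finset.coe_filter, Finset.mem_univ, true_and, Set.mem_ofPred_eq, ne_eq, not_iff_not]
    constructor
    · rintro rfl; exact le_rfl
    · intro hp
      exact Projectivization.submodule_injective
        (Submodule.eq_of_le_of_finrank_eq hp (by simp [Projectivization.finrank_submodule]))
  have key : s.card * ((q ^ h - q ^ 2) / (q - 1)) = t.card * 2 := by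
    refine Finset.card_mul_eq_card_mul (fun y B => y ∈ B) ?_ ?_
    · intro y hy
      have hy : y ≠ x := by simpa [s] using hy
      have h1 := aux_card_not_le (x.submodule ⊔ y.submodule)
      rw [aux_finrank_sup x y hy, hq] at h1
      rw [← h1, Nat.mul_div_cancel _ (by omega)]
      have h2 : Finset.bipartiteAbove (fun y B => y ∈ B) t y =
          (Finset.univ.filter (fun z : Projectivization F (Fin h → F) =>
            ¬ z.submodule ≤ x.submodule ⊔ y.submodule)).image (fun z => {x, y, z}) := by
        ext B
        simp only [Finset.mem_bipartiteAbove, t, Finset.mem_filter, Finset.mem_univ, true_and,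
          Finset.mem_image]
        constructor
        · rintro ⟨⟨hB, hx⟩, hyB⟩
          have h3 : ((B.erase x).erase y).card = 1 := by
            rw [Finset.card_erase_of_mem (Finset.mem_erase.2 ⟨hy, hyB⟩),
              Finset.card_erase_of_mem hx, hB.1]
          obtain ⟨z, hz⟩ := Finset.card_eq_one.1 h3
          have h4 : ({x, y, z} : Finset _) = B := by
            rw [← hz, Finset.insert_erase (Finset.mem_erase.2 ⟨hy, hyB⟩), Finset.insert_erase hx]
          refine ⟨z, ?_, h4⟩
          rw [← aux_isTriangle x y z hy, h4]
          exact hB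
        · rintro ⟨z, hz, rfl⟩
          exact ⟨⟨(aux_isTriangle x y z hy).2 hz, by simp⟩, by simp⟩
      rw [h2, Finset.card_image_of_injOn, ← Set.ncard_coe_finset]
      · simp
      · intro z hz w hw hzw
        simp only [Finset.coe_filter, Finset.mem_univ, true_and, Set.mem_ofPred_eq] at hz hw
        have h5 : z ∈ ({x, y, w} : Finset _) := by
          have : z ∈ ({x, y, z} : Finset (Projectivization F (Fin h → F))) := by simp
          have h6 : ({x, y, z} : Finset (Projectivization F (Fin h → F))) = {x, y, w} := hzw
          rwa [h6] at this
        simp only [Finset.mem_insert, Finset.mem_singleton] at h5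
        rcases h5 with rfl | rfl | h5
        · exact absurd le_sup_left hz
        · exact absurd le_sup_right hz
        · exact h5
    · intro B hB
      have hB : IsTriangle B ∧ x ∈ B := by simpa [t] using hB
      have : Finset.bipartiteBelow (fun y B => y ∈ B) s B = B.erase x := by
        ext y
        simp [Finset.mem_bipartiteBelow, s]
      rw [this, Finset.card_erase_of_mem hB.2, hB.1.1]
  have ht : {B : Finset (Projectivization F (Fin h → F)) | IsTriangle B ∧ x ∈ B}.ncard
      = t.card := by
    rw [← Set.ncard_coe_finset]
    simp [t]
  have hd : (q ^ h - q ^ 2) / (q - 1) * (q - 1) = q ^ h - q ^ 2 := by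
    apply Nat.div_mul_cancel
    obtain ⟨k, rfl⟩ := Nat.exists_eq_add_of_le hh
    have : q ^ (2 + k) - q ^ 2 = q ^ 2 * (q ^ k - 1) := by
      rw [Nat.mul_sub, pow_add, mul_one]
    rw [this]
    exact Dvd.dvd.mul_left (by simpa using Nat.sub_dvd_pow_sub_pow q 1 k) _
  rw [ht]
  calc 2 * (q - 1) ^ 2 * t.card = (t.card * 2) * (q - 1) ^ 2 := by ring
    _ = (s.card * (q - 1)) * ((q ^ h - q ^ 2) / (q - 1) * (q - 1)) := by rw [← key]; ring
    _ = (q ^ h - q) * (q ^ h - q ^ 2) := by rw [hs, hd]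
    _ = _ := by
      obtain ⟨k, rfl⟩ := Nat.exists_eq_add_of_le hh
      have a1 : q ^ (2 + k) - q ^ 2 = q ^ 2 * (q ^ k - 1) := by
        rw [Nat.mul_sub, pow_add, mul_one]
      have a2 : q ^ (2 + k) - q = q * (q ^ (1 + k) - 1) := by
        rw [Nat.mul_sub, mul_one, ← pow_succ']; congr 2; omega
      rw [a1, a2, show 2 + k - 1 = 1 + k by omega, show 2 + k - 2 = k by omega]
      ring
end

section
/- Let D = (P, ℬ) be a 2-(v,3,λ) design with λ odd, and let σ be an automorphism of D with σ² = id. Suppose x ≠ y are points with σ(x) = y. Then there exists a block B ∈ ℬ containing x and y with σ(B) = B, and the third point z of B (z ∈ B, z ∉ {x,y}) satisfies σ(z) = z. -/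
/-- Let `D = (P, ℬ)` be a `2-(v,3,λ)` design with `λ` odd, and let `σ`
be an involutory automorphism of `D`.  If `x ≠ y` are points with `σ x = y`, then
there is a block `B` containing `x` and `y` with `σ(B) = B`, and the third point of
`B` is fixed by `σ`. -/
theorem involution_fixes_a_block
    {P : Type*} [Fintype P] [DecidableEq P] (lam : ℕ)
    (ℬ : Finset (Finset P))
    (hblocks : ∀ B ∈ ℬ, B.card = 3)
    (hdesign : ∀ T : Finset P, T.card = 2 → (ℬ.filter (fun B => T ⊆ B)).card = lam)
    (hlam : Odd lam)
    (σ : Equiv.Perm P)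
    (hσaut : ∀ B ∈ ℬ, B.image σ ∈ ℬ)
    (hσ2 : σ * σ = 1)
    (x y : P) (hxy : x ≠ y) (hσx : σ x = y) :
    ∃ B ∈ ℬ, x ∈ B ∧ y ∈ B ∧ B.image σ = B ∧
      ∀ z ∈ B, z ≠ x → z ≠ y → σ z = z := by
  have hinv : ∀ a, σ (σ a) = a := fun a => by
    have := congrArg (fun t : Equiv.Perm P => t a) hσ2
    simpa using this
  have hσy : σ y = x := by rw [← hσx, hinv]
  have himg : ∀ B : Finset P, (B.image σ).image σ = B := fun B => by
    rw [Finset.image_image]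
    have : (σ ∘ σ : P → P) = id := funext hinv
    rw [this, Finset.image_id]
  have hcard := hdesign {x, y} (Finset.card_pair hxy)
  have key : ∃ B ∈ ℬ, x ∈ B ∧ y ∈ B ∧ B.image σ = B := by
    by_contra hno
    have hsum : ∑ _B ∈ ℬ.filter (fun B => {x, y} ⊆ B), (1 : ZMod 2) = 0 := by
      refine Finset.sum_involution (fun B _ => B.image σ) ?_ ?_ ?_ ?_
      · intro B _
        decide
      · intro B hB _ h
        simp only [Finset.mem_filter, Finset.insert_subset_iff, Finset.singleton_subset_iff] at hB
        exact hno ⟨B, hB.1, hB.2.1, hB.2.2, h⟩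
      · intro B hB
        simp only [Finset.mem_filter, Finset.insert_subset_iff, Finset.singleton_subset_iff] at hB ⊢
        exact ⟨hσaut B hB.1, Finset.mem_image.2 ⟨y, hB.2.2, hσy⟩,
          Finset.mem_image.2 ⟨x, hB.2.1, hσx⟩⟩
      · intro B _
        exact himg B
    rw [Finset.sum_const, hcard, nsmul_eq_mul, mul_one, ZMod.natCast_eq_zero_iff] at hsum
    obtain ⟨k, hk⟩ := hlam
    omega
  obtain ⟨B, hB, hx, hy, hfix⟩ := key
  refine ⟨B, hB, hx, hy, hfix, fun z hz hzx hzy => ?_⟩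
  have hsz : σ z ∈ B := by
    rw [← hfix]
    exact Finset.mem_image_of_mem σ hz
  have hBe : ({x, y, z} : Finset P) = B := by
    apply Finset.eq_of_subset_of_card_le
    · simp [Finset.insert_subset_iff, hx, hy, hz]
    · rw [hblocks B hB, Finset.card_eq_three.2 ⟨x, y, z, hxy, hzx.symm, hzy.symm, rfl⟩]
  rw [← hBe] at hsz
  simp only [Finset.mem_insert, Finset.mem_singleton] at hsz
  rcases hsz with h | h | h
  · exact absurd (σ.injective (h.trans hσy.symm)) hzy
  · exact absurd (σ.injective (h.trans hσx.symm)) hzx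
  · exact h
end

section
/- Let p be a prime and B a 3-element subset of the field 𝔽_p. Suppose that for every two distinct elements u, v of B there exist a ∈ 𝔽_p \ {0} and b ∈ 𝔽_p such that the affine map x ↦ ax + b maps B onto B and swaps u and v (equivalently, the setwise stabilizer of B in the group of affine permutations of 𝔽_p induces the full symmetric group S₃ on B). Then p = 3. -/
/-- Let `p` be a prime and `B` a `3`-element subset of `𝔽_p`.  If for
every two distinct `u, v ∈ B` there is an affine permutation `x ↦ a x + b` of `𝔽_p`
mapping `B` onto `B` and swapping `u` and `v` (i.e. the setwise stabilizer of `B` in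
the affine group induces `S₃` on `B`), then `p = 3`. -/
theorem affine_stabilizer_S3_implies_p_eq_three
    (p : ℕ) (hp : p.Prime) (B : Finset (ZMod p)) (hB : B.card = 3)
    (h : ∀ u ∈ B, ∀ v ∈ B, u ≠ v → ∃ a b : ZMod p, a ≠ 0 ∧
      B.image (fun x => a * x + b) = B ∧ a * u + b = v ∧ a * v + b = u) :
    p = 3 := by
  haveI : Fact p.Prime := ⟨hp⟩
  obtain ⟨u, v, w, huv, huw, hvw, rfl⟩ := Finset.card_eq_three.mp hB
  have key : ∀ x y z : ZMod p, x ≠ y → x ≠ z → y ≠ z →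
      ({u, v, w} : Finset (ZMod p)) = {x, y, z} → 2 * z = x + y := by
    intro x y z hxy hxz hyz hE
    rw [hE] at h
    obtain ⟨a, b, ha, hi, h1, h2⟩ := h x (by simp) y (by simp) hxy
    have ha1 : a = -1 := by
      have h3 : (a + 1) * (x - y) = 0 := by linear_combination h1 - h2
      rcases mul_eq_zero.mp h3 with h4 | h4
      · linear_combination h4
      · exact absurd (sub_eq_zero.mp h4) hxy
    have hz : a * z + b ∈ ({x, y, z} : Finset (ZMod p)) := by
      rw [← hi]
      exact Finset.mem_image_of_mem (fun x => a * x + b) (by simp)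
    subst ha1
    simp only [Finset.mem_insert, Finset.mem_singleton] at hz
    rcases hz with hz | hz | hz
    · exact absurd (by linear_combination hz - h2) hyz
    · exact absurd (by linear_combination hz - h1) hxz
    · linear_combination h1 - hz
  have k1 := key u v w huv huw hvw rfl
  have k2 := key v w u hvw huv.symm huw.symm (by ext t; simp; tauto)
  have h3 : (3 : ZMod p) * (w - u) = 0 := by linear_combination k1 - k2
  have h30 : ((3 : ℕ) : ZMod p) = 0 := by
    rcases mul_eq_zero.mp h3 with h4 | h4
    · exact_mod_cast h4
    · exact absurd (sub_eq_zero.mp h4).symm huw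
  exact (Nat.prime_dvd_prime_iff_eq hp Nat.prime_three).mp
    ((ZMod.natCast_eq_zero_iff 3 p).mp h30)
end

section
/- For every integer m ≥ 1, the integer (2^{4m+2} − 1)/3 does not divide 2^{6m+3} − 5. -/
/-- For every integer `m ≥ 1`, the integer `(2^{4m+2} - 1)/3` does
not divide `2^{6m+3} - 5`. -/
theorem third_of_mersenne_not_dvd
    (m : ℕ) (hm : 1 ≤ m) :
    ¬ ((((2 : ℤ) ^ (4 * m + 2) - 1) / 3) ∣ (2 : ℤ) ^ (6 * m + 3) - 5) := by
  have h8 : (8 : ℤ) ≤ 2 ^ (2 * m + 1) := by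
    calc (8 : ℤ) = 2 ^ 3 := by norm_num
      _ ≤ 2 ^ (2 * m + 1) := pow_le_pow_right₀ (by norm_num) (by omega)
  have h3 : (3 : ℤ) ∣ 2 ^ (4 * m + 2) - 1 := by
    have h := sub_dvd_pow_sub_pow (4 : ℤ) 1 (2 * m + 1)
    have e : (4 : ℤ) ^ (2 * m + 1) = 2 ^ (4 * m + 2) := by
      rw [show (4 : ℤ) = 2 ^ 2 by norm_num, ← pow_mul]
      congr 1
      ring
    rw [e, one_pow] at h
    norm_num at h
    exact h
  have e2 : (2 : ℤ) ^ (4 * m + 2) = (2 ^ (2 * m + 1)) ^ 2 := by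
    rw [← pow_mul]
    congr 1
    ring
  have e3 : (2 : ℤ) ^ (6 * m + 3) = (2 ^ (2 * m + 1)) ^ 3 := by
    rw [← pow_mul]
    congr 1
    ring
  rw [e2] at h3 ⊢
  rw [e3]
  generalize (2 : ℤ) ^ (2 * m + 1) = x at *
  obtain ⟨N, hN⟩ := h3
  rw [hN, Int.mul_ediv_cancel_left _ (by norm_num)]
  intro hd
  have h1 : N ∣ x - 5 := by
    have : x - 5 = (x ^ 3 - 5) - N * (3 * x) := by linear_combination (-x) * hN
    rw [this]
    exact dvd_sub hd (dvd_mul_right _ _)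
  have := Int.le_of_dvd (by linarith) h1
  nlinarith
end

section
/- Let q ≥ 3 be an odd integer and n ≥ 3 an odd integer. If the Gaussian binomial coefficient ((q^n−1)(q^{n−1}−1)) / ((q²−1)(q−1)) divides ((q^n−1)(q^n−6))/2 (as integers), then n = 3. -/
/-- Let `q ≥ 3` be odd and `n ≥ 3` odd.  If the Gaussian binomial
coefficient `((q^n-1)(q^{n-1}-1))/((q²-1)(q-1))` divides `((q^n-1)(q^n-6))/2`,
then `n = 3`. -/
theorem gaussian_binomial_dvd_implies_n_eq_three
    (q : ℤ) (n : ℕ) (hq : 3 ≤ q) (hqodd : Odd q) (hn : 3 ≤ n) (hnodd : Odd n)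
    (hdvd : ((q ^ n - 1) * (q ^ (n - 1) - 1)) / ((q ^ 2 - 1) * (q - 1)) ∣
      ((q ^ n - 1) * (q ^ n - 6)) / 2) :
    n = 3 := by
  obtain ⟨m, rfl⟩ := hnodd
  obtain ⟨k, hk⟩ := hqodd
  by_contra hne
  obtain ⟨j, rfl⟩ : ∃ j, m = j + 2 := ⟨m - 2, by omega⟩
  obtain ⟨A, hA⟩ : ∃ A, A = ∑ i ∈ Finset.range (2 * (j + 2) + 1), q ^ i := ⟨_, rfl⟩
  obtain ⟨B, hB⟩ : ∃ B, B = ∑ i ∈ Finset.range (j + 2), (q ^ 2) ^ i := ⟨_, rfl⟩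
  have hA1 : A * (q - 1) = q ^ (2 * (j + 2) + 1) - 1 := by
    rw [hA, geom_sum_mul]
  have hB1 : B * (q ^ 2 - 1) = q ^ (2 * (j + 2)) - 1 := by
    rw [hB, geom_sum_mul, pow_mul]
  have hBge : q ^ 2 + 1 ≤ B := by
    rw [hB, Finset.sum_range_succ', Finset.sum_range_succ']
    have : 0 ≤ ∑ i ∈ Finset.range j, (q ^ 2) ^ (i + 1 + 1) :=
      Finset.sum_nonneg fun i _ => by positivity
    simp only [zero_add, pow_one, pow_zero]
    linarith
  have hApos : 0 < A := by
    rw [hA]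
    exact Finset.sum_pos (fun i _ => by positivity) ⟨0, by simp⟩
  have e1 : ((q ^ (2 * (j + 2) + 1) - 1) * (q ^ (2 * (j + 2) + 1 - 1) - 1)) /
      ((q ^ 2 - 1) * (q - 1)) = A * B := by
    apply Int.ediv_eq_of_eq_mul_left
    · have h1 : 0 < q ^ 2 - 1 := by nlinarith
      have h2 : 0 < q - 1 := by linarith
      positivity
    · rw [Nat.add_sub_cancel, ← hA1, ← hB1]; ring
  have e2 : ((q ^ (2 * (j + 2) + 1) - 1) * (q ^ (2 * (j + 2) + 1) - 6)) / 2 =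
      A * (k * (q ^ (2 * (j + 2) + 1) - 6)) := by
    apply Int.ediv_eq_of_eq_mul_left (by norm_num)
    rw [← hA1]
    have : q - 1 = 2 * k := by linarith
    rw [this]; ring
  rw [e1, e2] at hdvd
  have h := Int.dvd_of_mul_dvd_mul_left hApos.ne' hdvd
  have h3 : B ∣ k * (q - 6) := by
    have : k * (q - 6) = k * (q ^ (2 * (j + 2) + 1) - 6) - B * ((q ^ 2 - 1) * q * k) := by
      rw [pow_succ]
      linear_combination (q * k) * hB1
    rw [this]
    exact dvd_sub h (dvd_mul_right _ _)
  have h0 : k * (q - 6) = 0 := by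
    apply Int.eq_zero_of_abs_lt_dvd h3
    rw [abs_lt]
    constructor <;> nlinarith
  rcases mul_eq_zero.1 h0 with h | h <;> omega
end
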